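/- arXiv:2001.05915 — 6 statements merged into one kernel-verified Lean document; each statement's English description precedes it below -/
import Mathlib

section
/- Let λ > 0, γ ∈ ℝ, and 0 < a ≤ 1/√λ. Then the function f_{a,λ}(β) := (β − γ)² + λ·aβ/(aβ + 1), defined for β ≥ 0, is strictly convex on [0, ∞). -/
/-- For `λ > 0`, `γ ∈ ℝ` and `0 < a ≤ 1/√λ`, the function
`f_{a,λ}(β) = (β − γ)² + λ a β/(a β + 1)` is strictly convex on `[0, ∞)`. -/
theorem strictConvexOn_fraction_penalty (lam a γ : ℝ)
    (hlam : 0 < lam) (ha : 0 < a) (ha' : a ≤ 1 / Real.sqrt lam) :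
    StrictConvexOn ℝ (Set.Ici (0 : ℝ))
      (fun β : ℝ => (β - γ) ^ 2 + lam * (a * β / (a * β + 1))) := by
  have hs : 0 < Real.sqrt lam := Real.sqrt_pos.mpr hlam
  have h1 : a * Real.sqrt lam ≤ 1 := (le_div_iff₀ hs).mp ha'
  have hla : lam * a ^ 2 ≤ 1 := by
    have h2 : (a * Real.sqrt lam) ^ 2 ≤ 1 := pow_le_one₀ (by positivity) h1
    rw [mul_pow, Real.sq_sqrt hlam.le] at h2
    linarith
  refine ⟨convex_Ici 0, ?_⟩
  intro x hx y hy hxy s t hs0 ht0 hst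
  have hx0 : 0 ≤ x := hx
  have hy0 : 0 ≤ y := hy
  simp only [smul_eq_mul]
  obtain rfl : s = 1 - t := by linarith
  have hz : 0 < (1 - t) * x + t * y := by
    rcases hx0.lt_or_eq with h | h
    · have := mul_pos hs0 h
      have := mul_nonneg ht0.le hy0
      linarith
    · have hy1 : 0 < y := lt_of_le_of_ne hy0 (by rw [h]; exact hxy)
      have := mul_pos ht0 hy1
      have := mul_nonneg hs0.le hx0
      linarith
  have hu : 1 ≤ a * x + 1 := by have := mul_nonneg ha.le hx0; linarith
  have hv : 1 ≤ a * y + 1 := by have := mul_nonneg ha.le hy0; linarith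
  have hw : 1 < a * ((1 - t) * x + t * y) + 1 := by have := mul_pos ha hz; linarith
  have huv := one_le_mul_of_one_le_of_one_le hu hv
  have hP : 1 < (a * x + 1) * (a * y + 1) * (a * ((1 - t) * x + t * y) + 1) := by
    nlinarith
  have hu0 : a * x + 1 ≠ 0 := by positivity
  have hv0 : a * y + 1 ≠ 0 := by positivity
  have hw0 : a * ((1 - t) * x + t * y) + 1 ≠ 0 := by linarith
  have key : (1 - t) * ((x - γ) ^ 2 + lam * (a * x / (a * x + 1)))
      + t * ((y - γ) ^ 2 + lam * (a * y / (a * y + 1)))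
      - (((1 - t) * x + t * y - γ) ^ 2 + lam * (a * ((1 - t) * x + t * y)
        / (a * ((1 - t) * x + t * y) + 1)))
      = (1 - t) * t * (x - y) ^ 2 * (1 - lam * a ^ 2 /
        ((a * x + 1) * (a * y + 1) * (a * ((1 - t) * x + t * y) + 1))) := by
    field_simp
    ring
  have hpos : 0 < 1 - lam * a ^ 2 /
        ((a * x + 1) * (a * y + 1) * (a * ((1 - t) * x + t * y) + 1)) := by
    rw [sub_pos, div_lt_one (by linarith)]
    linarith
  have hsq : 0 < (x - y) ^ 2 := by
    have := sub_ne_zero.mpr hxy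
    positivity
  have := mul_pos (mul_pos (mul_pos hs0 ht0) hsq) hpos
  linarith
end

section
/- Let λ > 0 and 0 < a ≤ 1/√λ, and let γ ≥ 0. Then the minimization problem min_{β ≥ 0} {(β − γ)² + λ·aβ/(aβ + 1)} has a unique minimizer β_λ, and β_λ = g_{a,λ}(γ) if γ > λa/2, while β_λ = 0 if γ ≤ λa/2, where g_{a,λ}(γ) = (1 + aγ)/(3a) · (1 + 2cos(φ_{a,λ}(γ)/3 − π/3)) − 1/a and φ_{a,λ}(γ) = arccos(27λa²/(4(1 + aγ)³) − 1). -/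
/-- `φ_{a,λ}(γ) = arccos(27λa²/(4(1 + aγ)³) − 1)` (for `γ ≥ 0`). -/
noncomputable def phiNN (a lam γ : ℝ) : ℝ :=
  Real.arccos (27 * lam * a ^ 2 / (4 * (1 + a * γ) ^ 3) - 1)

/-- `g_{a,λ}(γ) = (1 + aγ)/(3a) · (1 + 2cos(φ_{a,λ}(γ)/3 − π/3)) − 1/a` (for `γ ≥ 0`). -/
noncomputable def gNN (a lam γ : ℝ) : ℝ :=
  (1 + a * γ) / (3 * a) * (1 + 2 * Real.cos (phiNN a lam γ / 3 - Real.pi / 3)) - 1 / a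

theorem aux_root (a lam γ : ℝ) (hlam : 0 < lam) (ha : 0 < a) (hc : lam * a ^ 2 ≤ 1)
    (h : lam * a / 2 < γ) :
    0 < gNN a lam γ ∧ (a * gNN a lam γ + 1) ^ 2 * (γ - gNN a lam γ) = lam * a / 2 := by
  obtain ⟨c, hcdef⟩ : ∃ c, c = lam * a ^ 2 := ⟨_, rfl⟩
  obtain ⟨s, hs⟩ : ∃ s, s = 1 + a * γ := ⟨_, rfl⟩
  have hc0 : 0 < c := by rw [hcdef]; positivity
  have hs1 : 1 + c / 2 < s := by
    have := mul_lt_mul_of_pos_left h ha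
    rw [hs, hcdef]; nlinarith
  have hspos : 0 < s := by linarith
  have hs3 : 27 * c / 8 ≤ s ^ 3 := by
    have h1 : (1 + c / 2) ^ 3 ≤ s ^ 3 := by gcongr
    have h2 : 27 * c / 8 ≤ (1 + c / 2) ^ 3 := by
      have : (1 + c / 2) ^ 3 - 27 * c / 8 = (c - 1) ^ 2 * (c + 8) / 8 := by ring
      have : 0 ≤ (c - 1) ^ 2 * (c + 8) / 8 := by positivity
      linarith
    linarith
  have hphi : phiNN a lam γ = Real.arccos (27 * c / (4 * s ^ 3) - 1) := by
    rw [phiNN, hs, hcdef]; congr 1; ring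
  have hcos : Real.cos (phiNN a lam γ) = 27 * c / (4 * s ^ 3) - 1 := by
    rw [hphi, Real.cos_arccos]
    · have : 0 < 27 * c / (4 * s ^ 3) := by positivity
      linarith
    · have : 27 * c / (4 * s ^ 3) ≤ 2 := by
        rw [div_le_iff₀ (by positivity)]; linarith
      linarith
  have hp0 : 0 ≤ phiNN a lam γ := Real.arccos_nonneg _
  have hp1 : phiNN a lam γ ≤ Real.pi := Real.arccos_le_pi _
  obtain ⟨x, hx⟩ : ∃ x, x = Real.cos (phiNN a lam γ / 3 - Real.pi / 3) := ⟨_, rfl⟩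
  have hx3 : 4 * x ^ 3 - 3 * x = 1 - 27 * c / (4 * s ^ 3) := by
    rw [hx, ← Real.cos_three_mul,
      show 3 * (phiNN a lam γ / 3 - Real.pi / 3) = phiNN a lam γ - Real.pi by ring,
      Real.cos_sub_pi, hcos]
    ring
  have hxh : 1 / 2 ≤ x := by
    rw [hx, ← Real.cos_pi_div_three, ← Real.cos_neg (phiNN a lam γ / 3 - Real.pi / 3)]
    apply Real.cos_le_cos_of_nonneg_of_le_pi <;> linarith
  obtain ⟨t, ht⟩ : ∃ t, t = s / 3 * (1 + 2 * x) := ⟨_, rfl⟩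
  have hg : gNN a lam γ = (t - 1) / a := by
    rw [gNN, ← hx, ← hs, ht]; field_simp
  have hts : 2 * s / 3 ≤ t := by rw [ht]; nlinarith
  have hroot : t ^ 2 * (s - t) = c / 2 := by
    have e : t ^ 2 * (s - t) = 2 * s ^ 3 / 27 * (1 - (4 * x ^ 3 - 3 * x)) := by rw [ht]; ring
    rw [e, hx3]; field_simp; ring
  have ht1 : 1 < t := by
    by_contra hcon
    push Not at hcon
    have : t ^ 2 * (s - t) - (s - 1) = (1 - t) * (t ^ 2 + t + 1 - s * (1 + t)) := by ring
    have h4 : 0 ≤ t ^ 2 + t + 1 - s * (1 + t) := by nlinarith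
    have := mul_nonneg (sub_nonneg.2 hcon) h4
    linarith
  have hγ' : γ = (s - 1) / a := by rw [hs]; field_simp; ring
  refine ⟨by rw [hg]; apply div_pos <;> linarith, ?_⟩
  rw [hg, hγ']
  have : a * ((t - 1) / a) + 1 = t := by field_simp; ring
  rw [this, ← sub_div, show s - 1 - (t - 1) = s - t by ring, ← mul_div_assoc, hroot, hcdef]
  field_simp

theorem aux_strict (lam a γ b β : ℝ) (hlam : 0 < lam) (ha : 0 < a) (hc : lam * a ^ 2 ≤ 1)
    (hb : 0 ≤ b) (hβ : 0 ≤ β) (hne : β ≠ b)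
    (h : (b = 0 ∧ γ ≤ lam * a / 2) ∨
      (0 < b ∧ (a * b + 1) ^ 2 * (γ - b) = lam * a / 2)) :
    (b - γ) ^ 2 + lam * (a * b / (a * b + 1)) < (β - γ) ^ 2 + lam * (a * β / (a * β + 1)) := by
  have ht : 0 < a * β + 1 := by positivity
  have ht0 : 0 < a * b + 1 := by positivity
  rw [← sub_pos]
  rcases h with ⟨rfl, h⟩ | ⟨hb, h⟩
  · have hβ' : 0 < β := lt_of_le_of_ne hβ (Ne.symm hne)
    have e : (β - γ) ^ 2 + lam * (a * β / (a * β + 1)) -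
        ((0 - γ) ^ 2 + lam * (a * 0 / (a * 0 + 1))) =
        β * (2 * (lam * a / 2 - γ)) + β ^ 2 * ((a * β + (1 - lam * a ^ 2)) / (a * β + 1)) := by
      field_simp; ring
    rw [e]
    have h1 : 0 < a * β + (1 - lam * a ^ 2) := by nlinarith [mul_pos ha hβ']
    have h2 := mul_nonneg hβ (by linarith : 0 ≤ 2 * (lam * a / 2 - γ))
    have : 0 < β ^ 2 * ((a * β + (1 - lam * a ^ 2)) / (a * β + 1)) := by positivity
    linarith
  · have hγ : γ = b + lam * a / 2 / (a * b + 1) ^ 2 := by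
      field_simp; linarith
    have e : (β - γ) ^ 2 + lam * (a * β / (a * β + 1)) -
        ((b - γ) ^ 2 + lam * (a * b / (a * b + 1))) =
        (β - b) ^ 2 * (((a * β + 1) * (a * b + 1) ^ 2 - lam * a ^ 2) /
          ((a * β + 1) * (a * b + 1) ^ 2)) := by
      rw [hγ]; field_simp; ring
    rw [e]
    have hab := mul_pos ha hb
    have h1 : 0 < (a * β + 1) * (a * b + 1) ^ 2 - lam * a ^ 2 := by
      have h3 : 1 < (a * b + 1) ^ 2 := by nlinarith
      have h4 : 0 ≤ a * β := by positivity
      nlinarith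
    have h2 : 0 < (β - b) ^ 2 := by
      have := sub_ne_zero.2 hne
      positivity
    positivity

/-- For `λ > 0`, `0 < a ≤ 1/√λ` and `γ ≥ 0`, the problem
`min_{β ≥ 0} {(β − γ)² + λ a β/(a β + 1)}` has a unique minimizer `β_λ`, given by
`β_λ = g_{a,λ}(γ)` if `γ > λa/2`, and `β_λ = 0` if `γ ≤ λa/2`. -/
theorem unique_minimizer_thresholding (lam a γ : ℝ)
    (hlam : 0 < lam) (ha : 0 < a) (ha' : a ≤ 1 / Real.sqrt lam) (hγ : 0 ≤ γ) :
    (if lam * a / 2 < γ then gNN a lam γ else 0) ∈ Set.Ici (0 : ℝ) ∧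
    (∀ β ∈ Set.Ici (0 : ℝ),
      ((if lam * a / 2 < γ then gNN a lam γ else 0) - γ) ^ 2
          + lam * (a * (if lam * a / 2 < γ then gNN a lam γ else 0)
              / (a * (if lam * a / 2 < γ then gNN a lam γ else 0) + 1))
        ≤ (β - γ) ^ 2 + lam * (a * β / (a * β + 1))) ∧
    (∀ β ∈ Set.Ici (0 : ℝ),
      (∀ β' ∈ Set.Ici (0 : ℝ),
        (β - γ) ^ 2 + lam * (a * β / (a * β + 1))
          ≤ (β' - γ) ^ 2 + lam * (a * β' / (a * β' + 1))) →
      β = (if lam * a / 2 < γ then gNN a lam γ else 0)) := by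
  have hc : lam * a ^ 2 ≤ 1 := by
    have hsq : 0 < Real.sqrt lam := Real.sqrt_pos.2 hlam
    rw [le_div_iff₀ hsq] at ha'
    have h1 : (a * Real.sqrt lam) ^ 2 ≤ 1 := by
      have : 0 ≤ a * Real.sqrt lam := by positivity
      nlinarith
    rw [mul_pow, Real.sq_sqrt hlam.le] at h1
    linarith
  obtain ⟨b, hbdef⟩ : ∃ b, b = (if lam * a / 2 < γ then gNN a lam γ else 0) := ⟨_, rfl⟩
  rw [← hbdef]
  have key : (b = 0 ∧ γ ≤ lam * a / 2) ∨
      (0 < b ∧ (a * b + 1) ^ 2 * (γ - b) = lam * a / 2) := by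
    split_ifs at hbdef with h
    · right; rw [hbdef]; exact aux_root a lam γ hlam ha hc h
    · left; exact ⟨hbdef, not_lt.1 h⟩
  have hb : 0 ≤ b := by
    rcases key with h | h
    · exact h.1.ge
    · exact h.1.le
  refine ⟨hb, ?_, ?_⟩
  · intro β hβ
    by_cases hne : β = b
    · rw [hne]
    · exact (aux_strict lam a γ b β hlam ha hc hb hβ hne key).le
  · intro β hβ hmin
    by_contra hne
    exact absurd (hmin b hb) (not_le.2 (aux_strict lam a γ b β hlam ha hc hb hβ hne key))
end

section
/- Let λ > 0, 0 < a ≤ 1/√λ, and γ > λa/2 with γ ≥ 0. Then β := g_{a,λ}(γ) = (1 + aγ)/(3a) · (1 + 2cos(φ_{a,λ}(γ)/3 − π/3)) − 1/a, where φ_{a,λ}(γ) = arccos(27λa²/(4(1 + aγ)³) − 1), satisfies β > 0 and the first-order stationarity equation 2(β − γ)(aβ + 1)² + λa = 0 (equivalently, β is a critical point of β ↦ (β − γ)² + λ·aβ/(aβ + 1) on (0, ∞)). In particular, the quantity 27λa²/(4(1 + aγ)³) − 1 lies in [−1, 1], so φ_{a,λ}(γ) is well defined. -/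
/-- For `λ > 0`, `0 < a ≤ 1/√λ` and `γ ≥ 0` with `γ > λa/2`, the value `β = g_{a,λ}(γ)`
satisfies `β > 0` and the stationarity equation `2(β − γ)(aβ + 1)² + λa = 0`; moreover
`27λa²/(4(1 + aγ)³) − 1 ∈ [−1, 1]`, so `φ_{a,λ}(γ)` is well defined. -/
theorem gNN_pos_and_stationary (lam a γ : ℝ)
    (hlam : 0 < lam) (ha : 0 < a) (ha' : a ≤ 1 / Real.sqrt lam)
    (hγ0 : 0 ≤ γ) (hγ : lam * a / 2 < γ) :
    0 < gNN a lam γ ∧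
    2 * (gNN a lam γ - γ) * (a * gNN a lam γ + 1) ^ 2 + lam * a = 0 ∧
    (27 * lam * a ^ 2 / (4 * (1 + a * γ) ^ 3) - 1) ∈ Set.Icc (-1 : ℝ) 1 := by
  have hu : 0 < 1 + a * γ := by positivity
  have hL : 0 < lam * a ^ 2 := by positivity
  have huL : 1 + lam * a ^ 2 / 2 < 1 + a * γ := by nlinarith
  have hu3 : 0 < 4 * (1 + a * γ) ^ 3 := by positivity
  have hX : (27 * lam * a ^ 2 / (4 * (1 + a * γ) ^ 3) - 1) ∈ Set.Icc (-1 : ℝ) 1 := by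
    constructor
    · have : 0 ≤ 27 * lam * a ^ 2 / (4 * (1 + a * γ) ^ 3) := by positivity
      linarith
    · have : 27 * lam * a ^ 2 / (4 * (1 + a * γ) ^ 3) ≤ 2 := by
        rw [div_le_iff₀ hu3]
        have h1 : (1 + lam * a ^ 2 / 2) ^ 3 ≤ (1 + a * γ) ^ 3 := by gcongr
        have h2 : 27 * (lam * a ^ 2) ≤ (2 + lam * a ^ 2) ^ 3 := by
          have h3 : 0 ≤ (lam * a ^ 2 - 1) ^ 2 * (lam * a ^ 2 + 8) := by positivity
          nlinarith
        nlinarith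
      linarith
  have hφ0 : 0 ≤ phiNN a lam γ := Real.arccos_nonneg _
  have hφπ : phiNN a lam γ ≤ Real.pi := Real.arccos_le_pi _
  have hcosφ : Real.cos (phiNN a lam γ) = 27 * lam * a ^ 2 / (4 * (1 + a * γ) ^ 3) - 1 :=
    Real.cos_arccos hX.1 hX.2
  have hpi := Real.pi_pos
  have hc : 1 / 2 ≤ Real.cos (phiNN a lam γ / 3 - Real.pi / 3) := by
    rw [← Real.cos_neg, ← Real.cos_pi_div_three]
    apply Real.cos_le_cos_of_nonneg_of_le_pi <;> linarith
  have h3 : 4 * Real.cos (phiNN a lam γ / 3 - Real.pi / 3) ^ 3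
      - 3 * Real.cos (phiNN a lam γ / 3 - Real.pi / 3)
      = 1 - 27 * lam * a ^ 2 / (4 * (1 + a * γ) ^ 3) := by
    rw [← Real.cos_three_mul,
      show 3 * (phiNN a lam γ / 3 - Real.pi / 3) = phiNN a lam γ - Real.pi by ring,
      Real.cos_sub_pi, hcosφ]
    ring
  have hw : a * gNN a lam γ + 1 =
      (1 + a * γ) / 3 * (1 + 2 * Real.cos (phiNN a lam γ / 3 - Real.pi / 3)) := by
    unfold gNN
    field_simp
    ring
  generalize Real.cos (phiNN a lam γ / 3 - Real.pi / 3) = c at *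
  generalize gNN a lam γ = β at *
  have h4 : (1 + a * γ) ^ 3 * (4 * c ^ 3 - 3 * c - 1) = - (27 * (lam * a ^ 2) / 4) := by
    rw [h3]
    field_simp
    ring
  have hst : 2 * ((a * β + 1) - (1 + a * γ)) * (a * β + 1) ^ 2 + lam * a ^ 2 = 0 := by
    rw [hw]
    linear_combination (4 / 27) * h4
  have hw2 : 2 / 3 * (1 + a * γ) ≤ a * β + 1 := by
    rw [hw]; nlinarith
  refine ⟨?_, ?_, hX⟩
  · by_contra hβ
    have hw1 : a * β + 1 ≤ 1 := by nlinarith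
    generalize a * β + 1 = w at *
    generalize 1 + a * γ = u at *
    have hw0 : 0 < w := by linarith
    have h5 : 0 ≤ (1 - w) * ((w ^ 2 + w + 1) - u * (w + 1)) := by
      apply mul_nonneg
      · linarith
      · nlinarith
    nlinarith
  · apply mul_left_cancel₀ ha.ne'
    linear_combination hst
end

section
/- Let a > 0 and λ > 0, and define the threshold t_{a,λ} = λa/2 if λ ≤ 1/a², and t_{a,λ} = √λ − 1/(2a) if λ > 1/a². Define h_{a,λ}(γ) = g_{a,λ}(γ) if |γ| > t_{a,λ} and h_{a,λ}(γ) = 0 if |γ| ≤ t_{a,λ}, where g_{a,λ}(γ) = [(1 + a|γ|)/(3a) · (1 + 2cos(φ_{a,λ}(γ)/3 − π/3)) − 1/a]·sign(γ) and φ_{a,λ}(γ) = arccos(27λa²/(4(1 + a|γ|)³) − 1). Then for every γ ∈ ℝ, h_{a,λ}(γ) is a global minimizer over β ∈ ℝ of the function β ↦ (β − γ)² + λ·a|β|/(a|β| + 1). -/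
/-- `φ_{a,λ}(γ) = arccos(27λa²/(4(1 + a|γ|)³) − 1)`. -/
noncomputable def phiF (a lam γ : ℝ) : ℝ :=
  Real.arccos (27 * lam * a ^ 2 / (4 * (1 + a * |γ|) ^ 3) - 1)

/-- `g_{a,λ}(γ) = [(1 + a|γ|)/(3a) · (1 + 2cos(φ_{a,λ}(γ)/3 − π/3)) − 1/a] · sign(γ)`. -/
noncomputable def gF (a lam γ : ℝ) : ℝ :=
  ((1 + a * |γ|) / (3 * a) * (1 + 2 * Real.cos (phiF a lam γ / 3 - Real.pi / 3)) - 1 / a)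
    * Real.sign γ

/-- The threshold `t_{a,λ} = λa/2` if `λ ≤ 1/a²` and `t_{a,λ} = √λ − 1/(2a)` if `λ > 1/a²`. -/
noncomputable def tF (a lam : ℝ) : ℝ :=
  if lam ≤ 1 / a ^ 2 then lam * a / 2 else Real.sqrt lam - 1 / (2 * a)

/-- The thresholding function `h_{a,λ}(γ) = g_{a,λ}(γ)` for `|γ| > t_{a,λ}` and `0` otherwise. -/
noncomputable def hF (a lam γ : ℝ) : ℝ :=
  if tF a lam < |γ| then gF a lam γ else 0

theorem aux_key (c s y x : ℝ) (hy : 1 ≤ y) (hx : 1 ≤ x) (hc : c = 2 * y ^ 2 * (s - y))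
    (h : s - 1 / 2 ≤ y) :
    (y - s) ^ 2 + c * (1 - 1 / y) ≤ (x - s) ^ 2 + c * (1 - 1 / x) := by
  have hy0 : 0 < y := by linarith
  have hx0 : 0 < x := by linarith
  have e : (x - s) ^ 2 + c * (1 - 1 / x) - ((y - s) ^ 2 + c * (1 - 1 / y))
      = (x - y) ^ 2 * (x - 2 * (s - y)) / x := by
    rw [hc]; field_simp; ring
  have : 0 ≤ (x - y) ^ 2 * (x - 2 * (s - y)) / x := by
    apply div_nonneg _ hx0.le
    apply mul_nonneg (sq_nonneg _); linarith
  linarith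

theorem aux_zero (c s x : ℝ) (hx : 1 ≤ x) (h : 0 ≤ x ^ 2 + (1 - 2 * s) * x + c) :
    (1 - s) ^ 2 ≤ (x - s) ^ 2 + c * (1 - 1 / x) := by
  have hx0 : 0 < x := by linarith
  have e : (x - s) ^ 2 + c * (1 - 1 / x) - (1 - s) ^ 2
      = (x - 1) * (x ^ 2 + (1 - 2 * s) * x + c) / x := by
    field_simp; ring
  have : 0 ≤ (x - 1) * (x ^ 2 + (1 - 2 * s) * x + c) / x := by
    apply div_nonneg _ hx0.le
    exact mul_nonneg (by linarith) h
  linarith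

/-- anti-monotonicity of `x^2 (s - x)` beyond `2s/3`. -/
theorem aux_mono (s y z : ℝ) (hs : 0 < s) (hy : 2 * s / 3 ≤ y) (hz : 2 * s / 3 ≤ z)
    (h : y ^ 2 * (s - y) ≤ z ^ 2 * (s - z)) : z ≤ y := by
  by_contra! hlt
  have e : y ^ 2 * (s - y) - z ^ 2 * (s - z) = (z - y) * (z ^ 2 + z * y + y ^ 2 - s * (z + y)) := by
    ring
  have h2 : 0 < z ^ 2 + z * y + y ^ 2 - s * (z + y) := by
    obtain ⟨u, rfl⟩ : ∃ u, y = 2 * s / 3 + u := ⟨y - 2 * s / 3, by ring⟩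
    obtain ⟨v, rfl⟩ : ∃ v, z = 2 * s / 3 + u + v := ⟨z - (2 * s / 3 + u), by ring⟩
    have hu : 0 ≤ u := by linarith
    have hv : 0 < v := by linarith
    nlinarith [mul_pos hs hv, mul_nonneg hs.le hu, mul_nonneg hu hv.le, sq_nonneg u, sq_nonneg v]
  have := mul_pos (sub_pos.2 hlt) h2
  linarith

theorem aux_root_s10 (c s : ℝ) (hs : 0 < s) (hc : 0 < c) (h : 27 * c ≤ 8 * s ^ 3) :
    2 * s / 3 ≤ s / 3 * (1 + 2 * Real.cos (Real.arccos (27 * c / (4 * s ^ 3) - 1) / 3 - Real.pi / 3))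
    ∧ c = 2 * (s / 3 * (1 + 2 * Real.cos (Real.arccos (27 * c / (4 * s ^ 3) - 1) / 3 - Real.pi / 3))) ^ 2
      * (s - s / 3 * (1 + 2 * Real.cos (Real.arccos (27 * c / (4 * s ^ 3) - 1) / 3 - Real.pi / 3))) := by
  have hs3 : 0 < s ^ 3 := by positivity
  have hle : 27 * c / (4 * s ^ 3) - 1 ≤ 1 := by
    rw [sub_le_iff_le_add, div_le_iff₀ (by positivity)]; linarith
  have hge : -1 ≤ 27 * c / (4 * s ^ 3) - 1 := by
    have : 0 ≤ 27 * c / (4 * s ^ 3) := by positivity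
    linarith
  have hcos := Real.cos_arccos hge hle
  have h0 := Real.arccos_nonneg (27 * c / (4 * s ^ 3) - 1)
  have h1 := Real.arccos_le_pi (27 * c / (4 * s ^ 3) - 1)
  set p := Real.arccos (27 * c / (4 * s ^ 3) - 1) with hp
  have h3 := Real.cos_three_mul (p / 3 - Real.pi / 3)
  have e3 : 3 * (p / 3 - Real.pi / 3) = p - Real.pi := by ring
  rw [e3, Real.cos_sub_pi, hcos] at h3
  have hC : 1 / 2 ≤ Real.cos (p / 3 - Real.pi / 3) := by
    rw [← Real.cos_pi_div_three, ← Real.cos_neg (p / 3 - Real.pi / 3)]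
    apply Real.cos_le_cos_of_nonneg_of_le_pi <;> linarith [Real.pi_pos]
  set C := Real.cos (p / 3 - Real.pi / 3)
  constructor
  · nlinarith
  · have : 27 * c = (4 * s ^ 3) * (1 - (4 * C ^ 3 - 3 * C)) := by
      rw [← h3]; field_simp; ring
    linear_combination this / 27

theorem aux_pos (c s : ℝ) (hc : 0 < c) (hs : 1 ≤ s)
    (h : (c ≤ 1 ∧ 1 + c / 2 < s) ∨ (1 < c ∧ Real.sqrt c + 1 / 2 < s)) (y : ℝ)
    (hy : y = s / 3 * (1 + 2 * Real.cos (Real.arccos (27 * c / (4 * s ^ 3) - 1) / 3 - Real.pi / 3))) :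
    1 ≤ y ∧ c = 2 * y ^ 2 * (s - y) ∧ s - 1 / 2 ≤ y := by
  obtain ⟨q, hq, rfl⟩ : ∃ q, 0 < q ∧ c = q ^ 2 :=
    ⟨Real.sqrt c, Real.sqrt_pos.2 hc, (Real.sq_sqrt hc.le).symm⟩
  rw [Real.sqrt_sq hq.le] at h
  have hq2 : q + 1 / 2 < s := by
    rcases h with h | h
    · nlinarith [sq_nonneg (q - 1)]
    · exact h.2
  have h27 : 27 * q ^ 2 ≤ 8 * s ^ 3 := by
    have h1 : (2 * q + 1) ^ 3 ≤ (2 * s) ^ 3 := by gcongr; linarith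
    have h2 : (2 * q + 1) ^ 3 - 27 * q ^ 2 = (q - 1) ^ 2 * (8 * q + 1) := by ring
    have h3 : 0 ≤ (q - 1) ^ 2 * (8 * q + 1) := by positivity
    nlinarith
  obtain ⟨r1, r2⟩ := aux_root_s10 (q ^ 2) s (by linarith) hc h27
  rw [← hy] at r1 r2
  refine ⟨?_, r2, ?_⟩
  · rcases le_total 1 (2 * s / 3) with h1 | h1
    · linarith
    · apply aux_mono s y 1 (by linarith) r1 h1
      rcases h with h | h
      · linarith
      · nlinarith
  · rcases le_total (s - 1 / 2) (2 * s / 3) with h1 | h1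
    · linarith
    · apply aux_mono s y _ (by linarith) r1 h1
      nlinarith

theorem aux_obj (a lam γ β : ℝ) (ha : 0 < a) :
    a ^ 2 * ((|β| - |γ|) ^ 2 + lam * (a * |β| / (a * |β| + 1)))
      = ((1 + a * |β|) - (1 + a * |γ|)) ^ 2 + (lam * a ^ 2) * (1 - 1 / (1 + a * |β|)) := by
  have : 0 < 1 + a * |β| := by positivity
  have : 0 < a * |β| + 1 := by positivity
  field_simp
  ring

theorem aux_abs (γ β : ℝ) : (|β| - |γ|) ^ 2 ≤ (β - γ) ^ 2 := by
  exact sq_le_sq.2 (abs_abs_sub_abs_le β γ)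

theorem aux_thr (a lam : ℝ) (ha : 0 < a) (hlam : 0 < lam) :
    (lam * a ^ 2 ≤ 1 ∧ a * tF a lam = lam * a ^ 2 / 2) ∨
    (1 < lam * a ^ 2 ∧ a * tF a lam = Real.sqrt (lam * a ^ 2) - 1 / 2) := by
  unfold tF
  split_ifs with h
  · left
    rw [le_div_iff₀ (by positivity)] at h
    exact ⟨h, by ring⟩
  · right
    rw [le_div_iff₀ (by positivity)] at h
    refine ⟨not_le.1 h, ?_⟩
    rw [Real.sqrt_mul hlam.le, Real.sqrt_sq ha.le]
    field_simp

/-- For `a > 0` and `λ > 0`, for every `γ ∈ ℝ`, `h_{a,λ}(γ)` is a global minimizer over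
`β ∈ ℝ` of `β ↦ (β − γ)² + λ a|β|/(a|β| + 1)`. -/
theorem hF_isGlobalMinimizer (a lam : ℝ) (ha : 0 < a) (hlam : 0 < lam) :
    ∀ γ β : ℝ,
      (hF a lam γ - γ) ^ 2 + lam * (a * |hF a lam γ| / (a * |hF a lam γ| + 1))
        ≤ (β - γ) ^ 2 + lam * (a * |β| / (a * |β| + 1)) := by
  intro γ β
  have hx : 1 ≤ 1 + a * |β| := by nlinarith [mul_nonneg ha.le (abs_nonneg β)]
  have hs : 1 ≤ 1 + a * |γ| := by nlinarith [mul_nonneg ha.le (abs_nonneg γ)]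
  have hc : 0 < lam * a ^ 2 := by positivity
  have ha2 : 0 < a ^ 2 := by positivity
  have hthr := aux_thr a lam ha hlam
  suffices H : (hF a lam γ - γ) ^ 2 = (|hF a lam γ| - |γ|) ^ 2 ∧
      ((1 + a * |hF a lam γ|) - (1 + a * |γ|)) ^ 2
        + (lam * a ^ 2) * (1 - 1 / (1 + a * |hF a lam γ|))
      ≤ ((1 + a * |β|) - (1 + a * |γ|)) ^ 2 + (lam * a ^ 2) * (1 - 1 / (1 + a * |β|)) by
    obtain ⟨H1, H2⟩ := H
    rw [← aux_obj a lam γ _ ha, ← aux_obj a lam γ _ ha] at H2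
    have H3 := le_of_mul_le_mul_left H2 ha2
    rw [H1]
    linarith [aux_abs γ β]
  by_cases ht : tF a lam < |γ|
  · have hat : a * tF a lam < a * |γ| := by gcongr
    have hP := aux_pos (lam * a ^ 2) (1 + a * |γ|) hc hs (by
      rcases hthr with h | h
      · left; exact ⟨h.1, by linarith [h.2]⟩
      · right; exact ⟨h.1, by linarith [h.2]⟩) _ rfl
    have hg : hF a lam γ = ((1 + a * |γ|) / 3 * (1 + 2 * Real.cos (Real.arccos (27 * (lam * a ^ 2) / (4 * (1 + a * |γ|) ^ 3) - 1) / 3 - Real.pi / 3)) - 1) / a * Real.sign γ := by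
      rw [hF, if_pos ht, gF, phiF, ← mul_assoc 27 lam]
      field_simp
    set y := (1 + a * |γ|) / 3 * (1 + 2 * Real.cos (Real.arccos (27 * (lam * a ^ 2) / (4 * (1 + a * |γ|) ^ 3) - 1) / 3 - Real.pi / 3)) with hy
    obtain ⟨p1, p2, p3⟩ := hP
    have hz : 0 ≤ (y - 1) / a := div_nonneg (by linarith) ha.le
    have hγ : γ ≠ 0 := by
      rintro rfl
      rw [abs_zero, mul_zero] at hat
      rcases hthr with h | h
      · linarith [h.2]
      · have : 1 < Real.sqrt (lam * a ^ 2) := by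
          rw [Real.lt_sqrt zero_le_one]; linarith [h.1]
        linarith [h.2]
    have habs : |hF a lam γ| = (y - 1) / a := by
      rw [hg]
      rcases lt_or_gt_of_ne hγ with h | h
      · rw [Real.sign_of_neg h, mul_neg_one, abs_neg, abs_of_nonneg hz]
      · rw [Real.sign_of_pos h, mul_one, abs_of_nonneg hz]
    constructor
    · rw [habs, hg]
      rcases lt_or_gt_of_ne hγ with h | h
      · rw [Real.sign_of_neg h, abs_of_neg h]; ring
      · rw [Real.sign_of_pos h, abs_of_pos h]; ring
    · have e : 1 + a * |hF a lam γ| = y := by rw [habs]; field_simp; ring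
      rw [e]
      exact aux_key _ _ _ _ p1 hx p2 p3
  · have hat : a * |γ| ≤ a * tF a lam := by
      have := not_lt.1 ht
      gcongr
    have h0 : hF a lam γ = 0 := by rw [hF, if_neg ht]
    rw [h0]
    refine ⟨by simp, ?_⟩
    have := aux_zero (lam * a ^ 2) (1 + a * |γ|) (1 + a * |β|) hx (by
      generalize 1 + a * |β| = x at *
      rcases hthr with ⟨h1, h2⟩ | ⟨h1, h2⟩
      · nlinarith [mul_nonneg (sub_nonneg.2 hx) (sub_nonneg.2 (h1.trans hx)), mul_le_mul_of_nonneg_right (hat.trans h2.le) (zero_le_one.trans hx)]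
      · have h3 := Real.sq_sqrt hc.le
        nlinarith [sq_nonneg (x - Real.sqrt (lam * a ^ 2)), mul_le_mul_of_nonneg_right (hat.trans h2.le) (zero_le_one.trans hx)])
    simpa using this
end

section
/- Let a > 0 and λ > 0, let Y ∈ ℝ^{m×n} with m ≤ n, and let Y = U[Diag(σ(Y)), O_{m,n−m}]Vᵀ be a singular value decomposition of Y, where U ∈ ℝ^{m×m} and V ∈ ℝ^{n×n} are orthogonal, σ(Y) = (σ₁(Y), …, σ_m(Y)) are the singular values of Y in non-increasing order, and O_{m,n−m} is the m×(n−m) zero matrix. Then the matrix G_{a,λ}(Y) := U[Diag(H_{a,λ}(σ(Y))), O_{m,n−m}]Vᵀ, where H_{a,λ}(σ(Y)) = (h_{a,λ}(σ₁(Y)), …, h_{a,λ}(σ_m(Y))), is a global minimizer over X ∈ ℝ^{m×n} of the function X ↦ ‖X − Y‖_F² + λP_a(X). -/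
open Matrix
attribute [local instance] Matrix.frobeniusNormedAddCommGroup Matrix.frobeniusNormedSpace

/-- The singular values of a real `m × n` matrix `X` (in some order):
the square roots of the eigenvalues of the positive semidefinite matrix `X * Xᴴ = X * Xᵀ`. -/
noncomputable def singVals {m n : ℕ} (X : Matrix (Fin m) (Fin n) ℝ) : Fin m → ℝ :=
  fun i => Real.sqrt ((Matrix.isHermitian_mul_conjTranspose_self X).eigenvalues i)

/-- The non-convex surrogate `P_a(X) = ∑_{i=1}^m a σ_i(X) / (a σ_i(X) + 1)`. -/
noncomputable def Pa {m n : ℕ} (a : ℝ) (X : Matrix (Fin m) (Fin n) ℝ) : ℝ :=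
  ∑ i : Fin m, a * singVals X i / (a * singVals X i + 1)

/-- The `m × n` matrix `[Diag(v), O_{m,n−m}]`: the diagonal matrix of `v` padded with zeros. -/
def diagPad {m n : ℕ} (v : Fin m → ℝ) : Matrix (Fin m) (Fin n) ℝ :=
  Matrix.of fun i j => if (i : ℕ) = (j : ℕ) then v i else 0

lemma key_scalar (s L u : ℝ) (hs : 1 < s) (hL : 0 < L) (hq : u^3 - s*u^2 + L/2 = 0)
    (hu : 2*s/3 ≤ u) (h1 : L < (s-1/2)^2) (h2 : 1 + L/2 < s ∨ 3/2 < s) :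
    1 ≤ u ∧ ∀ v, 1 ≤ v → (u-s)^2 - L/u ≤ (v-s)^2 - L/v := by
  have mono : ∀ w, u ≤ w → 0 ≤ w^3 - s*w^2 + L/2 := by
    intro w hw
    have : w^3 - s*w^2 + L/2 = (w-u)*(w^2+w*u+u^2 - s*(w+u)) := by linear_combination hq
    rw [this]
    apply mul_nonneg (by linarith)
    have : 0 ≤ (w-u) := by linarith
    nlinarith [mul_nonneg this this, mul_nonneg this (by linarith : 0 ≤ u - 2*s/3), mul_nonneg (by linarith : (0:ℝ) ≤ u) (by linarith : 0 ≤ u - 2*s/3)]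
  have hus : s - 1/2 ≤ u := by
    by_contra! h
    have := mono _ h.le
    nlinarith
  have hu1 : 1 ≤ u := by
    rcases h2 with h2 | h2
    · by_contra! h
      have := mono _ h.le
      nlinarith
    · linarith
  refine ⟨hu1, fun v hv => ?_⟩
  have hu0 : 0 < u := by linarith
  have hv0 : 0 < v := by linarith
  have hLe : L = 2*u^2*(s-u) := by linarith
  have : (v-s)^2 - L/v - ((u-s)^2 - L/u) = (v-u)^2*(v+2*u-2*s)/v := by
    rw [hLe]; field_simp; ring
  have h3 : 0 ≤ (v-u)^2*(v+2*u-2*s)/v := by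
    apply div_nonneg _ hv0.le
    apply mul_nonneg (sq_nonneg _); linarith
  linarith

lemma amgm (L s : ℝ) (hL : 0 < L) (h1 : L < (s-1/2)^2) (hs : 1 < s) : 27*L ≤ 8*s^3 := by
  nlinarith [mul_nonneg (by linarith : 0 ≤ s) (sq_nonneg (s-3/2)), sq_nonneg (s-3/2)]

lemma cubic_root (L s : ℝ) (hs : 1 < s) (hL : 0 < L) (h : 27*L ≤ 8*s^3) :
    let u := s/3 * (1 + 2*Real.cos (Real.arccos (27*L/(4*s^3) - 1)/3 - Real.pi/3))
    u^3 - s*u^2 + L/2 = 0 ∧ 2*s/3 ≤ u := by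
  intro u
  have hs3 : 0 < s^3 := by positivity
  set φ := Real.arccos (27*L/(4*s^3) - 1) with hφ
  have hcos : Real.cos φ = 27*L/(4*s^3) - 1 := by
    apply Real.cos_arccos
    · have : 0 < 27*L/(4*s^3) := by positivity
      linarith
    · have : 27*L/(4*s^3) ≤ 2 := by rw [div_le_iff₀ (by positivity)]; linarith
      linarith
  set c := Real.cos (φ/3 - Real.pi/3) with hc
  have h3 : 4*c^3 - 3*c = 1 - 27*L/(4*s^3) := by
    rw [hc, ← Real.cos_three_mul]
    rw [show 3*(φ/3 - Real.pi/3) = φ - Real.pi by ring, Real.cos_sub_pi, hcos]; ring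
  have hcge : 1/2 ≤ c := by
    rw [← Real.cos_pi_div_three, hc, ← Real.cos_abs (φ/3 - Real.pi/3)]
    have h0 := Real.arccos_nonneg (27*L/(4*s^3) - 1)
    have h1 := Real.arccos_le_pi (27*L/(4*s^3) - 1)
    rw [← hφ] at h0 h1
    apply Real.cos_le_cos_of_nonneg_of_le_pi (abs_nonneg _)
    · linarith [Real.pi_pos]
    · rw [abs_le]; constructor <;> linarith
  constructor
  · have : u^3 - s*u^2 = s^3/27*(2*(4*c^3-3*c) - 2) := by simp only [u]; ring
    rw [this, h3]; field_simp; ring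
  · simp only [u]; nlinarith

lemma conv_obj (a lam γ x : ℝ) (ha : 0 < a) (hx : 0 ≤ x) :
    (x-γ)^2 + lam*(a*x/(a*x+1)) =
      (((1+a*x)-(1+a*γ))^2 - (lam*a^2)/(1+a*x) + lam*a^2)/a^2 := by
  have : a*x+1 ≠ 0 := by positivity
  have : 1+a*x ≠ 0 := by positivity
  field_simp; ring

lemma hF_min (a lam γ : ℝ) (ha : 0 < a) (hlam : 0 < lam) (hγ : 0 ≤ γ) :
    0 ≤ hF a lam γ ∧ ∀ x, 0 ≤ x →
      (hF a lam γ - γ)^2 + lam*(a*hF a lam γ/(a*hF a lam γ+1)) ≤ (x-γ)^2 + lam*(a*x/(a*x+1)) := by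
  have hL : 0 < lam*a^2 := by positivity
  have hsq : (a*Real.sqrt lam)^2 = lam*a^2 := by rw [mul_pow, Real.sq_sqrt hlam.le]; ring
  have hr0 : 0 ≤ a*Real.sqrt lam := by positivity
  have hle : lam ≤ 1/a^2 ↔ lam*a^2 ≤ 1 := le_div_iff₀ (by positivity)
  have ht : a * tF a lam = if lam*a^2 ≤ 1 then lam*a^2/2 else a*Real.sqrt lam - 1/2 := by
    unfold tF
    simp only [hle]
    split_ifs
    · ring
    · field_simp
  unfold hF
  rw [abs_of_nonneg hγ]
  split_ifs with h
  · have hat : a*tF a lam < a*γ := mul_lt_mul_of_pos_left h ha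
    rw [ht] at hat
    set r := a*Real.sqrt lam with hr
    have h12 : 1 < 1 + a*γ ∧ lam*a^2 < (1+a*γ-1/2)^2 ∧ (1 + lam*a^2/2 < 1+a*γ ∨ 3/2 < 1+a*γ) := by
      rw [← hsq] at *
      split_ifs at hat with h1
      · refine ⟨by nlinarith, ?_, Or.inl (by linarith)⟩
        have : r < 1 + a*γ - 1/2 := by nlinarith [sq_nonneg (r-1)]
        nlinarith
      · have : 1 < r := by nlinarith
        refine ⟨by nlinarith, ?_, Or.inr (by linarith)⟩
        nlinarith
    obtain ⟨hs, h1, h2⟩ := h12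
    have hγ0 : 0 < γ := by
      by_contra! h'
      nlinarith
    obtain ⟨hc1, hc2⟩ := cubic_root (lam*a^2) (1+a*γ) hs hL (amgm _ _ hL h1 hs)
    obtain ⟨hk1, hk2⟩ := key_scalar _ _ _ hs hL hc1 hc2 h1 h2
    have hg : 1 + a * gF a lam γ = (1+a*γ)/3 * (1 + 2*Real.cos (Real.arccos (27*(lam*a^2)/(4*(1+a*γ)^3) - 1)/3 - Real.pi/3)) := by
      unfold gF phiF
      rw [abs_of_nonneg hγ, Real.sign_of_pos hγ0, ← mul_assoc 27 lam]
      field_simp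
      ring
    rw [← hg] at hk1 hk2
    have hg0 : 0 ≤ gF a lam γ := by
      by_contra! h'
      nlinarith
    refine ⟨hg0, fun x hx => ?_⟩
    rw [conv_obj _ _ _ _ ha hx, conv_obj _ _ _ _ ha hg0]
    have := hk2 (1+a*x) (by nlinarith [mul_nonneg ha.le hx])
    gcongr
  · refine ⟨le_rfl, fun x hx => ?_⟩
    have hat : a*γ ≤ a*tF a lam := mul_le_mul_of_nonneg_left (not_lt.mp h) ha.le
    rw [ht] at hat
    set r := a*Real.sqrt lam with hr
    have hv0 : 0 ≤ a*x := by positivity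
    have key : 2*(a*γ)*(a*x+1) ≤ (a*x)*(a*x+1) + lam*a^2 := by
      rw [← hsq] at *
      split_ifs at hat with h1
      · nlinarith
      · nlinarith [sq_nonneg (a*x+1-r)]
    have e : (x-γ)^2 + lam*(a*x/(a*x+1)) - γ^2 = x*((a*x)*(a*x+1) + lam*a^2 - 2*(a*γ)*(a*x+1))/(a*(a*x+1)) := by
      field_simp; ring
    have : 0 ≤ x*((a*x)*(a*x+1) + lam*a^2 - 2*(a*γ)*(a*x+1))/(a*(a*x+1)) := by
      apply div_nonneg _ (by positivity)
      apply mul_nonneg hx; linarith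
    simp
    linarith

lemma comb_bound {m : ℕ} (x y c p : Fin m → ℝ) (R Q : Fin m → Fin m → ℝ)
    (hx : ∀ i, 0 ≤ x i) (hy : ∀ i, 0 ≤ y i) (hp : ∀ i, 0 ≤ p i)
    (hc : ∀ i j, c j ≤ (x i - y j)^2 + p i) (hc0 : ∀ j, c j ≤ (y j)^2)
    (hR1 : ∀ i, ∑ j, R i j^2 ≤ 1) (hR2 : ∀ j, ∑ i, R i j^2 ≤ 1)
    (hQ1 : ∀ i, ∑ j, Q i j^2 ≤ 1) (hQ2 : ∀ j, ∑ i, Q i j^2 ≤ 1) :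
    ∑ j, c j ≤ ∑ i, x i^2 + ∑ j, y j^2 - 2*∑ i, ∑ j, x i * y j * (R i j * Q i j) + ∑ i, p i := by
  set B : Fin m → Fin m → ℝ := fun i j => (R i j^2 + Q i j^2)/2 with hB
  have hB0 : ∀ i j, 0 ≤ B i j := fun i j => by simp only [hB]; positivity
  have hB1 : ∀ i, ∑ j, B i j ≤ 1 := fun i => by
    simp only [hB, ← Finset.sum_div, Finset.sum_add_distrib]; linarith [hR1 i, hQ1 i]
  have hB2 : ∀ j, ∑ i, B i j ≤ 1 := fun i => by
    simp only [hB, ← Finset.sum_div, Finset.sum_add_distrib]; linarith [hR2 i, hQ2 i]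
  have h1 : ∑ i, ∑ j, x i * y j * (R i j * Q i j) ≤ ∑ i, ∑ j, x i * y j * B i j := by
    gcongr with i _ j _
    · exact mul_nonneg (hx i) (hy j)
    · simp only [hB]; nlinarith [sq_nonneg (R i j - Q i j)]
  have h2 : ∑ i, ∑ j, B i j * c j ≤ ∑ i, ∑ j, B i j * ((x i - y j)^2 + p i) := by
    exact Finset.sum_le_sum fun i _ => Finset.sum_le_sum fun j _ => mul_le_mul_of_nonneg_left (hc i j) (hB0 i j)
  have h3 : ∑ i, ∑ j, B i j * ((x i - y j)^2 + p i) =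
      ∑ i, (∑ j, B i j) * (x i^2 + p i) + ∑ j, (∑ i, B i j) * y j^2
        - 2*∑ i, ∑ j, x i * y j * B i j := by
    simp only [Finset.sum_mul, Finset.mul_sum]
    rw [Finset.sum_comm (f := fun j i => B i j * y j^2)]
    simp only [← Finset.sum_add_distrib, ← Finset.sum_sub_distrib]
    refine Finset.sum_congr rfl fun i _ => Finset.sum_congr rfl fun j _ => ?_
    ring
  have h4 : ∑ i, (∑ j, B i j) * (x i^2 + p i) ≤ ∑ i, (x i^2 + p i) :=
    Finset.sum_le_sum fun i _ => by nlinarith [hB1 i, hp i, sq_nonneg (x i)]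
  have h5 : ∑ j, (c j - (∑ i, B i j) * c j) ≤ ∑ j, (y j^2 - (∑ i, B i j) * y j^2) :=
    Finset.sum_le_sum fun j _ => by nlinarith [hB2 j, hc0 j]
  have h6 : ∑ i, ∑ j, B i j * c j = ∑ j, (∑ i, B i j) * c j := by
    rw [Finset.sum_comm]; simp only [Finset.sum_mul]
  rw [Finset.sum_add_distrib] at h4
  rw [Finset.sum_sub_distrib, Finset.sum_sub_distrib] at h5
  linarith

lemma frob_sq {m n : ℕ} (A : Matrix (Fin m) (Fin n) ℝ) : ‖A‖^2 = (A * Aᵀ).trace := by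
  rw [Matrix.frobenius_norm_def, ← Real.sqrt_eq_rpow, Real.sq_sqrt (by positivity)]
  simp [Matrix.trace, Matrix.mul_apply, sq]

lemma diagPad_mul_transpose {m n : ℕ} (hmn : m ≤ n) (v w : Fin m → ℝ) :
    (diagPad v : Matrix (Fin m) (Fin n) ℝ) * (diagPad (n := n) w)ᵀ = diagonal (fun i => v i * w i) := by
  ext i j
  simp only [diagPad, mul_apply, transpose_apply, of_apply, diagonal_apply]
  rw [Finset.sum_eq_single (Fin.castLE hmn i)]
  · by_cases h : i = j
    · simp [h]
    · have : ¬ (j:ℕ) = i := fun h' => h (Fin.ext h'.symm)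
      simp [h, this]
  · intro b _ hb
    have : ¬ (i:ℕ) = b := fun h' => hb (Fin.ext h'.symm)
    simp [this]
  · simp

lemma sum_singVals {m n : ℕ} (hmn : m ≤ n) (U : Matrix (Fin m) (Fin m) ℝ) (V : Matrix (Fin n) (Fin n) ℝ)
    (hU : Uᵀ * U = 1) (hV : Vᵀ * V = 1) (h : Fin m → ℝ) (hh : ∀ i, 0 ≤ h i) (f : ℝ → ℝ) :
    ∑ i, f (singVals (U * diagPad (n := n) h * Vᵀ) i) = ∑ i, f (h i) := by
  set G := U * diagPad (n := n) h * Vᵀ with hG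
  have hGG : G * Gᴴ = U * diagonal (fun i => h i * h i) * Uᵀ := by
    rw [conjTranspose_eq_transpose_of_trivial, hG, ← diagPad_mul_transpose hmn]
    simp only [transpose_mul, transpose_transpose, Matrix.mul_assoc]
    rw [← Matrix.mul_assoc Vᵀ V, hV, Matrix.one_mul]
  have hch : (G * Gᴴ).charpoly = (diagonal (fun i => h i * h i)).charpoly := by
    rw [hGG, charpoly_mul_comm, ← Matrix.mul_assoc, hU, Matrix.one_mul]
  have hr := (isHermitian_mul_conjTranspose_self G).roots_charpoly_eq_eigenvalues
  rw [hch, charpoly_diagonal, Polynomial.roots_prod _ _ (Finset.prod_ne_zero_iff.mpr fun i _ => Polynomial.X_sub_C_ne_zero _)] at hr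
  simp only [Polynomial.roots_X_sub_C, Multiset.bind_singleton] at hr
  have := congrArg (fun s => (s.map (fun t => f (Real.sqrt t))).sum) hr
  simp only [Multiset.map_map] at this
  simp only [Function.comp_def, Real.sqrt_mul_self (hh _)] at this
  exact this.symm

lemma svd_exists {m n : ℕ} (X : Matrix (Fin m) (Fin n) ℝ) :
    ∃ (W : Matrix (Fin m) (Fin m) ℝ) (Z : Matrix (Fin m) (Fin n) ℝ) (e : Fin m → ℝ),
      Wᵀ * W = 1 ∧ X = W * (diagonal (singVals X) * Z) ∧ Z * Zᵀ = diagonal e ∧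
      (∀ i, e i ≤ 1) ∧ diagonal e * Z = Z := by
  set hH := isHermitian_mul_conjTranspose_self X with hHdef
  set W : Matrix (Fin m) (Fin m) ℝ := (hH.eigenvectorUnitary : Matrix (Fin m) (Fin m) ℝ) with hW
  have hWW : Wᵀ * W = 1 := by
    have := Unitary.coe_star_mul_self hH.eigenvectorUnitary
    rwa [star_eq_conjTranspose, conjTranspose_eq_transpose_of_trivial] at this
  have hWW' : W * Wᵀ = 1 := mul_eq_one_comm.mp hWW
  have hsp : X * Xᵀ = W * diagonal hH.eigenvalues * Wᵀ := by
    have := hH.spectral_theorem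
    rw [Unitary.conjStarAlgAut_apply, star_eq_conjTranspose] at this
    exact this
  have hx2 : ∀ i, hH.eigenvalues i = singVals X i ^ 2 := fun i => by
    unfold singVals
    rw [Real.sq_sqrt ((posSemidef_self_mul_conjTranspose X).eigenvalues_nonneg i)]
  set x := singVals X with hx
  set Z0 := Wᵀ * X with hZ0
  have hZZ : Z0 * Z0ᵀ = diagonal (fun i => x i ^2) := by
    rw [hZ0, transpose_mul, transpose_transpose, Matrix.mul_assoc, ← Matrix.mul_assoc X, hsp]
    rw [Matrix.mul_assoc, Matrix.mul_assoc, hWW, Matrix.mul_one, ← Matrix.mul_assoc, hWW, Matrix.one_mul]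
    congr 1; ext i; exact hx2 i
  have hzero : ∀ i k, x i = 0 → Z0 i k = 0 := by
    intro i k hi
    have := congrFun (congrFun hZZ i) i
    simp only [mul_apply, transpose_apply, diagonal_apply_eq, hi] at this
    rw [zero_pow (by norm_num), Finset.sum_eq_zero_iff_of_nonneg (fun _ _ => mul_self_nonneg _)] at this
    exact mul_self_eq_zero.mp (this k (Finset.mem_univ _))
  refine ⟨W, diagonal (fun i => (x i)⁻¹) * Z0, fun i => if x i = 0 then 0 else 1, hWW, ?_, ?_, ?_, ?_⟩
  · have : diagonal x * (diagonal (fun i => (x i)⁻¹) * Z0) = Z0 := by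
      ext i k
      simp only [diagonal_mul]
      by_cases hi : x i = 0
      · simp [hi, hzero i k hi]
      · field_simp
    rw [this, hZ0, ← Matrix.mul_assoc, hWW', Matrix.one_mul]
  · rw [transpose_mul, diagonal_transpose, Matrix.mul_assoc, ← Matrix.mul_assoc Z0, hZZ,
      diagonal_mul_diagonal, diagonal_mul_diagonal]
    congr 1; ext i
    by_cases hi : x i = 0
    · simp [hi]
    · simp [hi]; field_simp
  · intro i; dsimp only; split_ifs <;> norm_num
  · ext i k
    simp only [diagonal_mul]
    by_cases hi : x i = 0
    · simp [hi]
    · simp [hi]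

lemma col_le_one {m n : ℕ} (Q : Matrix (Fin m) (Fin n) ℝ) (e : Fin m → ℝ)
    (h1 : Q * Qᵀ = diagonal e) (h2 : diagonal e * Q = Q) (j : Fin n) :
    ∑ i, Q i j^2 ≤ 1 := by
  have hP : (Qᵀ * Q) * (Qᵀ * Q) = Qᵀ * Q := by
    rw [Matrix.mul_assoc, ← Matrix.mul_assoc Q, h1, h2]
  have hs : ∀ k, (Qᵀ * Q) k j = (Qᵀ * Q) j k := fun k => by
    simp [mul_apply, mul_comm]
  have e1 : ∑ i, Q i j^2 = (Qᵀ * Q) j j := by simp [mul_apply, sq]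
  have := congrFun (congrFun hP j) j
  rw [mul_apply] at this
  simp only [hs] at this
  rw [e1]
  have h3 : (Qᵀ * Q) j j * (Qᵀ * Q) j j ≤ ∑ k, (Qᵀ * Q) j k * (Qᵀ * Q) j k :=
    Finset.single_le_sum (f := fun k => (Qᵀ * Q) j k * (Qᵀ * Q) j k)
      (fun _ _ => mul_self_nonneg _) (Finset.mem_univ j)
  rw [this] at h3
  nlinarith

theorem svt_core {m n : ℕ} (hmn : m ≤ n) (a lam : ℝ)
    (ha : 0 < a) (hlam : 0 < lam)
    (Y : Matrix (Fin m) (Fin n) ℝ)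
    (U : Matrix (Fin m) (Fin m) ℝ) (V : Matrix (Fin n) (Fin n) ℝ)
    (hU : Uᵀ * U = 1) (hV : Vᵀ * V = 1)
    (σ : Fin m → ℝ) (hσ0 : ∀ i, 0 ≤ σ i)
    (hσanti : ∀ i j : Fin m, i ≤ j → σ j ≤ σ i)
    (hY : Y = U * diagPad (n := n) σ * Vᵀ) :
    ∀ X : Matrix (Fin m) (Fin n) ℝ,
      ‖U * diagPad (n := n) (fun i => hF a lam (σ i)) * Vᵀ - Y‖ ^ 2
          + lam * Pa a (U * diagPad (n := n) (fun i => hF a lam (σ i)) * Vᵀ)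
        ≤ ‖X - Y‖ ^ 2 + lam * Pa a X := by
  intro X
  have hUU' : U * Uᵀ = 1 := mul_eq_one_comm.mp hU
  have hVV' : V * Vᵀ = 1 := mul_eq_one_comm.mp hV
  obtain ⟨W, Z, e, hW, hX, hZ1, he, hZ2⟩ := svd_exists X
  have hWW' : W * Wᵀ = 1 := mul_eq_one_comm.mp hW
  set x := singVals X with hx
  have hx0 : ∀ i, 0 ≤ x i := fun i => Real.sqrt_nonneg _
  set h : Fin m → ℝ := fun i => hF a lam (σ i) with hh
  have hh0 : ∀ i, 0 ≤ h i := fun i => (hF_min a lam (σ i) ha hlam (hσ0 i)).1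
  have hPG : Pa a (U * diagPad (n := n) h * Vᵀ) = ∑ i, a * h i / (a * h i + 1) :=
    sum_singVals hmn U V hU hV h hh0 (fun t => a * t / (a * t + 1))
  have tr : ∀ v w : Fin m → ℝ, ((U * diagPad (n := n) v * Vᵀ) * (U * diagPad (n := n) w * Vᵀ)ᵀ).trace
      = ∑ i, v i * w i := by
    intro v w
    have : (U * diagPad (n := n) v * Vᵀ) * (U * diagPad (n := n) w * Vᵀ)ᵀ
        = U * (diagonal (fun i => v i * w i) * Uᵀ) := by
      rw [← diagPad_mul_transpose hmn]
      simp only [transpose_mul, transpose_transpose, Matrix.mul_assoc]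
      rw [← Matrix.mul_assoc Vᵀ V, hV, Matrix.one_mul]
    rw [this, trace_mul_comm, Matrix.mul_assoc, hU, Matrix.mul_one, trace_diagonal]
  have hGn : ‖U * diagPad (n := n) h * Vᵀ - Y‖^2 = ∑ i, (h i - σ i)^2 := by
    have : U * diagPad (n := n) h * Vᵀ - Y = U * diagPad (n := n) (fun i => h i - σ i) * Vᵀ := by
      rw [hY, ← Matrix.sub_mul, ← Matrix.mul_sub]
      congr 2
      ext i j
      simp only [diagPad, Matrix.sub_apply, of_apply]
      split_ifs with hij <;> simp
    rw [this, frob_sq, tr]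
    simp [sq]
  set R := Uᵀ * W with hR
  set Q := Z * V with hQ
  have hQ1 : Q * Qᵀ = diagonal e := by
    rw [hQ, transpose_mul, Matrix.mul_assoc, ← Matrix.mul_assoc V, hVV', Matrix.one_mul, hZ1]
  have hQ2 : diagonal e * Q = Q := by rw [hQ, ← Matrix.mul_assoc, hZ2]
  have hR1 : R * Rᵀ = 1 := by
    rw [hR, transpose_mul, transpose_transpose, Matrix.mul_assoc, ← Matrix.mul_assoc W, hWW', Matrix.one_mul, hU]
  have hR2 : Rᵀ * R = 1 := mul_eq_one_comm.mp hR1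
  have trXX : (X * Xᵀ).trace = ∑ i, x i^2 := by
    have h1 := (isHermitian_mul_conjTranspose_self X).trace_eq_sum_eigenvalues
    refine Eq.trans h1 ?_
    refine Finset.sum_congr rfl fun i _ => ?_
    rw [hx]; unfold singVals
    rw [Real.sq_sqrt ((posSemidef_self_mul_conjTranspose X).eigenvalues_nonneg i)]
    rfl
  have trXY : (X * Yᵀ).trace = ∑ i, ∑ j, x i * σ j * (R j i * Q i (Fin.castLE hmn j)) := by
    have h1 : X * Yᵀ = W * (diagonal x * (Q * (diagPad (n := n) σ)ᵀ) * Uᵀ) := by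
      rw [hY, hX]
      simp only [transpose_mul, transpose_transpose, Matrix.mul_assoc, hQ]
    rw [h1, trace_mul_comm, Matrix.mul_assoc, ← hR, trace]
    refine Finset.sum_congr rfl fun i _ => ?_
    rw [diag_apply, mul_apply]
    refine Finset.sum_congr rfl fun j _ => ?_
    have h2 : (Q * (diagPad (n := n) σ)ᵀ) i j = Q i (Fin.castLE hmn j) * σ j := by
      simp only [diagPad, mul_apply, transpose_apply, of_apply]
      rw [Finset.sum_eq_single (Fin.castLE hmn j)]
      · simp
      · intro b _ hb
        have : ¬ (j:ℕ) = b := fun h' => hb (Fin.ext h'.symm)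
        simp [this]
      · simp
    rw [diagonal_mul, h2]; ring
  have trYX : (Y * Xᵀ).trace = (X * Yᵀ).trace := by
    rw [← trace_transpose, transpose_mul, transpose_transpose]
  have hXn : ‖X - Y‖^2 = ∑ i, x i^2 + ∑ j, σ j^2
      - 2 * ∑ i, ∑ j, x i * σ j * (R j i * Q i (Fin.castLE hmn j)) := by
    have hYY : (Y * Yᵀ).trace = ∑ j, σ j^2 := by
      rw [hY, tr]; simp [sq]
    rw [frob_sq, transpose_sub, Matrix.sub_mul, Matrix.mul_sub, Matrix.mul_sub, trace_sub,
      trace_sub, trace_sub, trYX, trXX, trXY, hYY]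
    ring
  have hPX : lam * Pa a X = ∑ i, lam * (a * x i / (a * x i + 1)) := by
    unfold Pa; rw [Finset.mul_sum]
  have hmin := fun j => (hF_min a lam (σ j) ha hlam (hσ0 j)).2
  rw [hGn, hPG, hXn, hPX, Finset.mul_sum, ← Finset.sum_add_distrib]
  apply comb_bound x σ _ _ (fun i j => R j i) (fun i j => Q i (Fin.castLE hmn j)) hx0 hσ0
  · intro i
    have := hx0 i
    positivity
  · intro i j
    exact hmin j (x i) (hx0 i)
  · intro j
    have := hmin j 0 le_rfl
    simpa using this
  · intro i
    exact col_le_one R 1 (by rw [hR1]; exact diagonal_one.symm) (by simp) i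
  · intro j
    exact col_le_one Rᵀ 1 (by rw [transpose_transpose, hR2]; exact diagonal_one.symm) (by simp) j
  · intro i
    have h1 := congrFun (congrFun hQ1 i) i
    rw [diagonal_apply_eq, mul_apply] at h1
    refine le_trans ?_ (he i)
    rw [← h1]
    have h3 : ∑ j : Fin m, Q i (Fin.castLE hmn j)^2
        = ∑ k ∈ Finset.univ.map (Fin.castLEEmb hmn), Q i k^2 := by
      rw [Finset.sum_map]; rfl
    rw [h3]
    simp only [transpose_apply, ← sq]
    exact Finset.sum_le_sum_of_subset_of_nonneg (Finset.subset_univ _) (fun _ _ _ => sq_nonneg _)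
  · intro j
    exact col_le_one Q e hQ1 hQ2 _

/-- Let `Y = U [Diag(σ(Y)), O_{m,n−m}] Vᵀ` be an SVD of `Y ∈ ℝ^{m×n}` (`m ≤ n`), with `U, V`
orthogonal and `σ₁(Y) ≥ ⋯ ≥ σ_m(Y) ≥ 0`. Then
`G_{a,λ}(Y) = U [Diag(h_{a,λ}(σ(Y))), O_{m,n−m}] Vᵀ` is a global minimizer over `X` of
`X ↦ ‖X − Y‖_F² + λ P_a(X)`. -/
theorem svt_isGlobalMinimizer {m n : ℕ} (hmn : m ≤ n) (a lam : ℝ)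
    (ha : 0 < a) (hlam : 0 < lam)
    (Y : Matrix (Fin m) (Fin n) ℝ)
    (U : Matrix (Fin m) (Fin m) ℝ) (V : Matrix (Fin n) (Fin n) ℝ)
    (hU : Uᵀ * U = 1) (hV : Vᵀ * V = 1)
    (σ : Fin m → ℝ) (hσ0 : ∀ i, 0 ≤ σ i)
    (hσanti : ∀ i j : Fin m, i ≤ j → σ j ≤ σ i)
    (hY : Y = U * diagPad σ * Vᵀ) :
    ∀ X : Matrix (Fin m) (Fin n) ℝ,
      ‖U * diagPad (fun i => hF a lam (σ i)) * Vᵀ - Y‖ ^ 2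
          + lam * Pa a (U * diagPad (fun i => hF a lam (σ i)) * Vᵀ)
        ≤ ‖X - Y‖ ^ 2 + lam * Pa a X := by
  exact svt_core hmn a lam ha hlam Y U V hU hV σ hσ0 hσanti hY
end

section
/- Let λ > 0 and 0 < a ≤ 1/√λ, and let γ ≥ 0 with γ ≤ λa/2. Then for all β ≥ 0, (β − γ)² + λ·aβ/(aβ + 1) ≥ γ², i.e., β = 0 is a global minimizer of f_{a,λ}(β) = (β − γ)² + λ·aβ/(aβ + 1) on [0, ∞), and it is the unique one when γ < λa/2 or the strict convexity condition 0 < a ≤ 1/√λ holds. -/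
/-- For `λ > 0`, `0 < a ≤ 1/√λ` and `0 ≤ γ ≤ λa/2`: for all `β ≥ 0`,
`(β − γ)² + λ a β/(a β + 1) ≥ γ²`, i.e. `β = 0` (with value `f(0) = γ²`) is a global
minimizer of `f_{a,λ}` on `[0, ∞)`; moreover (since the strict convexity condition
`0 < a ≤ 1/√λ` holds) it is the unique minimizer. -/
theorem zero_branch_minimizer (lam a γ : ℝ)
    (hlam : 0 < lam) (ha : 0 < a) (ha' : a ≤ 1 / Real.sqrt lam)
    (hγ0 : 0 ≤ γ) (hγ : γ ≤ lam * a / 2) :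
    (∀ β : ℝ, 0 ≤ β → γ ^ 2 ≤ (β - γ) ^ 2 + lam * (a * β / (a * β + 1))) ∧
    (∀ β : ℝ, 0 ≤ β →
      (∀ β' : ℝ, 0 ≤ β' →
        (β - γ) ^ 2 + lam * (a * β / (a * β + 1))
          ≤ (β' - γ) ^ 2 + lam * (a * β' / (a * β' + 1))) →
      β = 0) := by
  have h1 : lam * a ^ 2 ≤ 1 := by
    have hs : 0 < Real.sqrt lam := Real.sqrt_pos.mpr hlam
    have h2 : a * Real.sqrt lam ≤ 1 := (le_div_iff₀ hs).mp ha'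
    have h3 : (a * Real.sqrt lam) ^ 2 ≤ 1 := pow_le_one₀ (by positivity) h2
    rw [mul_pow, Real.sq_sqrt hlam.le] at h3
    linarith
  have key : ∀ β : ℝ, 0 ≤ β →
      γ ^ 2 + a * β ^ 3 / (a * β + 1) ≤ (β - γ) ^ 2 + lam * (a * β / (a * β + 1)) := by
    intro β hβ
    have hp : 0 < a * β + 1 := by positivity
    have e : (β - γ) ^ 2 + lam * (a * β / (a * β + 1)) - (γ ^ 2 + a * β ^ 3 / (a * β + 1))
        = (β ^ 2 * (1 - lam * a ^ 2) + β * (a * β + 1) * (lam * a - 2 * γ)) / (a * β + 1) := by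
      field_simp
      ring
    have h4 : 0 ≤ 1 - lam * a ^ 2 := by linarith
    have h5 : 0 ≤ lam * a - 2 * γ := by linarith
    have h6 : 0 ≤ (β ^ 2 * (1 - lam * a ^ 2) + β * (a * β + 1) * (lam * a - 2 * γ)) / (a * β + 1) := by
      positivity
    linarith
  refine ⟨fun β hβ => ?_, fun β hβ h => ?_⟩
  · have h7 : 0 ≤ a * β ^ 3 / (a * β + 1) := by positivity
    linarith [key β hβ]
  · by_contra hne
    have hpos : 0 < β := lt_of_le_of_ne hβ (Ne.symm hne)
    have h7 : 0 < a * β ^ 3 / (a * β + 1) := by positivity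
    have h8 := h 0 le_rfl
    have h9 := key β hβ
    simp only [mul_zero, zero_div, add_zero, zero_sub, neg_sq] at h8
    linarith
end
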